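/- (DIANA+ gradient-estimator bound.) Let f_1, …, f_n : ℝ^d → ℝ be differentiable, convex, bounded below and L_i-smooth for symmetric positive semidefinite matrices L_i; let f = (1/n) Σ_i f_i be 𝐋-smooth for a symmetric PSD matrix 𝐋 and bounded below, with L = λmax(𝐋). Let C_1, …, C_n be mutually independent sketches of proper samplings S_i, set L̃max = max_i λmax(P̃_i ∘ L_i), let h_1, …, h_n be vectors with h_i ∈ range(L_i), and define g = (1/n) Σ_{i=1}^n [ L_i^{1/2} C_i L_i^{†1/2} (∇f_i(x) − h_i) + h_i ]. Then E[g] = ∇f(x), and for all x, y ∈ ℝ^d: E[‖g − ∇f(y)‖²] ≤ 2 (L + 2 L̃max / n) D_f(x, y) + (2 L̃max / n) · (1/n) Σ_{i=1}^n ‖h_i − ∇f_i(y)‖²_{L_i†}, where D_f(x,y) = f(x) − f(y) − ⟨∇f(y), x − y⟩. -/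

import Mathlib

open scoped BigOperators RealInnerProductSpace
open Matrix

noncomputable section

/-- A proper sampling on `{1,…,d}`: a finitely supported probability distribution over
subsets of `Fin d` whose marginal probabilities are all positive. -/
structure Sampling (d : ℕ) where
  prob : Finset (Fin d) → ℝ
  nonneg : ∀ S, 0 ≤ prob S
  total : ∑ S : Finset (Fin d), prob S = 1
  margPos : ∀ j : Fin d, 0 < ∑ S : Finset (Fin d), if j ∈ S then prob S else 0

namespace Sampling

variable {d : ℕ} (μ : Sampling d)

/-- Marginal probability `p_j = Prob(j ∈ S)`. -/
def marg (j : Fin d) : ℝ := ∑ S : Finset (Fin d), if j ∈ S then μ.prob S else 0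

/-- Probability matrix `P`, with entries `p_{jl} = Prob({j,l} ⊆ S)`. -/
def probMatrix : Matrix (Fin d) (Fin d) ℝ :=
  Matrix.of fun j l => ∑ S : Finset (Fin d), if j ∈ S ∧ l ∈ S then μ.prob S else 0

/-- The matrix `P̄` with entries `p_{jl}/(p_j p_l)`. -/
def Pbar : Matrix (Fin d) (Fin d) ℝ :=
  Matrix.of fun j l => μ.probMatrix j l / (μ.marg j * μ.marg l)

/-- The matrix `P̃ = P̄ − E` where `E` is the all-ones matrix. -/
def Ptilde : Matrix (Fin d) (Fin d) ℝ := μ.Pbar - Matrix.of fun _ _ => (1 : ℝ)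

/-- The unbiased diagonal sketch `C` associated with a realization `S` of the sampling. -/
def sketch (S : Finset (Fin d)) : Matrix (Fin d) (Fin d) ℝ :=
  Matrix.diagonal fun j => if j ∈ S then (μ.marg j)⁻¹ else 0

end Sampling

/-- Largest eigenvalue of a symmetric matrix, via the Rayleigh quotient. -/
def lambdaMax {d : ℕ} (M : Matrix (Fin d) (Fin d) ℝ) : ℝ :=
  sSup {r : ℝ | ∃ v : Fin d → ℝ, v ⬝ᵥ v = 1 ∧ r = v ⬝ᵥ M.mulVec v}

/-- Smallest eigenvalue of a symmetric matrix, via the Rayleigh quotient. -/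
def lambdaMin {d : ℕ} (M : Matrix (Fin d) (Fin d) ℝ) : ℝ :=
  sInf {r : ℝ | ∃ v : Fin d → ℝ, v ⬝ᵥ v = 1 ∧ r = v ⬝ᵥ M.mulVec v}

/-- `Mdag` is the Moore–Penrose pseudoinverse of `M`. -/
def IsMoorePenrose {m n : Type*} [Fintype m] [Fintype n]
    (M : Matrix m n ℝ) (Mdag : Matrix n m ℝ) : Prop :=
  M * Mdag * M = M ∧ Mdag * M * Mdag = Mdag ∧
    (M * Mdag)ᵀ = M * Mdag ∧ (Mdag * M)ᵀ = Mdag * M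

/-- Vectors in `ℝ^d` with the Euclidean inner product. -/
abbrev Vec (d : ℕ) := EuclideanSpace ℝ (Fin d)

/-- Action of a matrix on a Euclidean vector. -/
def mact {d e : ℕ} (M : Matrix (Fin e) (Fin d) ℝ) (x : Vec d) : Vec e :=
  Matrix.toEuclideanLin M x

/-- Quadratic form `xᵀ M x`, i.e. the squared `M`-seminorm `‖x‖²_M`. -/
def quad {d : ℕ} (M : Matrix (Fin d) (Fin d) ℝ) (x : Vec d) : ℝ := ⟪x, mact M x⟫

/-- `f` is `M`-smooth: `f x ≤ f y + ⟨∇f(y), x−y⟩ + ½ (x−y)ᵀ M (x−y)` for all `x, y`. -/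
def MSmooth {d : ℕ} (f : Vec d → ℝ) (M : Matrix (Fin d) (Fin d) ℝ) : Prop :=
  ∀ x y : Vec d, f x ≤ f y + ⟪gradient f y, x - y⟫ + (1 / 2) * quad M (x - y)

/-- Random iterates driven by i.i.d. draws: `traj x0 step k ω` is the `k`-th iterate along
the sample path `ω` of `k` draws. -/
def traj {V Ω : Type*} (x0 : V) (step : V → Ω → V) : ∀ k : ℕ, (Fin k → Ω) → V
  | 0, _ => x0
  | k + 1, ω => step (traj x0 step k fun i => ω i.castSucc) (ω (Fin.last k))

/-- Expectation `E[φ(x^k)]` of a functional of the `k`-th iterate, over `k` i.i.d. draws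
with one-step distribution `P`. -/
def trajExp {V Ω : Type*} [Fintype Ω] (P : Ω → ℝ) (x0 : V) (step : V → Ω → V)
    (φ : V → ℝ) (k : ℕ) : ℝ :=
  ∑ ω : Fin k → Ω, (∏ i, P (ω i)) * φ (traj x0 step k ω)


theorem mact_mul {d : ℕ} (M N : Matrix (Fin d) (Fin d) ℝ) (x : Vec d) :
    mact (M * N) x = mact M (mact N x) := by
  ext j
  simp [mact, Matrix.toLpLin_apply, Matrix.mulVec_mulVec]

theorem mact_sub {d : ℕ} (M : Matrix (Fin d) (Fin d) ℝ) (x y : Vec d) :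
    mact M (x - y) = mact M x - mact M y :=
  map_sub _ _ _

theorem mact_add {d : ℕ} (M : Matrix (Fin d) (Fin d) ℝ) (x y : Vec d) :
    mact M (x + y) = mact M x + mact M y :=
  map_add _ _ _

theorem mact_smul {d : ℕ} (M : Matrix (Fin d) (Fin d) ℝ) (t : ℝ) (x : Vec d) :
    mact M (t • x) = t • mact M x :=
  map_smul _ _ _

theorem inner_mact {d : ℕ} (M : Matrix (Fin d) (Fin d) ℝ) (x y : Vec d) :
    ⟪x, mact M y⟫ = ⟪mact Mᵀ x, y⟫ := by
  simp [mact, EuclideanSpace.inner_eq_star_dotProduct, Matrix.toLpLin_apply,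
    Matrix.mulVec_transpose, Matrix.dotProduct_mulVec, dotProduct_comm]

theorem quad_eq_dotProduct {d : ℕ} (M : Matrix (Fin d) (Fin d) ℝ) (x : Vec d) :
    quad M x = x.ofLp ⬝ᵥ M *ᵥ x.ofLp := by
  simp [quad, mact, EuclideanSpace.inner_eq_star_dotProduct, Matrix.toLpLin_apply,
    dotProduct_comm]

theorem quad_smul {d : ℕ} (M : Matrix (Fin d) (Fin d) ℝ) (t : ℝ) (x : Vec d) :
    quad M (t • x) = t ^ 2 * quad M x := by
  simp only [quad, mact_smul, inner_smul_left, inner_smul_right, conj_trivial]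
  ring

theorem quad_mul_self {d : ℕ} {A : Matrix (Fin d) (Fin d) ℝ} (hA : Aᵀ = A) (x : Vec d) :
    quad (A * A) x = ‖mact A x‖ ^ 2 := by
  rw [quad, mact_mul, inner_mact, hA, real_inner_self_eq_norm_sq]

/-- The Rayleigh quotients of a matrix are bounded above. -/
theorem bddAbove_rayleigh {d : ℕ} (M : Matrix (Fin d) (Fin d) ℝ) :
    BddAbove {r : ℝ | ∃ v : Fin d → ℝ, v ⬝ᵥ v = 1 ∧ r = v ⬝ᵥ M.mulVec v} := by
  refine ⟨‖(Matrix.toEuclideanLin M).toContinuousLinearMap‖, ?_⟩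
  rintro r ⟨v, hv, rfl⟩
  have hn : ‖(WithLp.toLp 2 v : Vec d)‖ = 1 := by
    rw [← sq_eq_sq₀ (norm_nonneg _) zero_le_one, EuclideanSpace.real_norm_sq_eq]
    simpa [dotProduct, sq] using hv
  have h := quad_eq_dotProduct M (WithLp.toLp 2 v)
  simp only at h
  rw [← h, quad]
  refine (real_inner_le_norm _ _).trans ?_
  have := (Matrix.toEuclideanLin M).toContinuousLinearMap.le_opNorm (WithLp.toLp 2 v)
  rw [hn] at this ⊢
  simpa [mact] using this

theorem quad_le_lambdaMax {d : ℕ} (M : Matrix (Fin d) (Fin d) ℝ) (x : Vec d) :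
    quad M x ≤ lambdaMax M * ‖x‖ ^ 2 := by
  rcases eq_or_ne x 0 with rfl | hx
  · simp [quad]
  have hx' : ‖x‖ ≠ 0 := norm_ne_zero_iff.2 hx
  have hle : quad M (‖x‖⁻¹ • x) ≤ lambdaMax M := by
    refine le_csSup (bddAbove_rayleigh M) ⟨_, ?_, quad_eq_dotProduct M _⟩
    have : ‖‖x‖⁻¹ • x‖ ^ 2 = 1 := by
      rw [norm_smul, norm_inv, norm_norm, inv_mul_cancel₀ hx', one_pow]
    rw [EuclideanSpace.real_norm_sq_eq] at this
    simpa only [dotProduct, sq] using this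
  rw [quad_smul, inv_pow, inv_mul_le_iff₀ (by positivity)] at hle
  linarith

/-- A quadratic form that is nonnegative has nonnegative largest eigenvalue. -/
theorem lambdaMax_nonneg {d : ℕ} {M : Matrix (Fin d) (Fin d) ℝ} (hM : ∀ x, 0 ≤ quad M x) :
    0 ≤ lambdaMax M := by
  refine Real.sSup_nonneg ?_
  rintro r ⟨v, -, rfl⟩
  simpa [quad_eq_dotProduct] using hM (WithLp.toLp 2 v)

/-- For positive semidefinite `A` with `A * A = L`, and positive semidefinite `B` with
`B * B` the pseudoinverse `L†`, the product `A * B` is the projection `L * L†`. -/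
theorem sqrt_mul_sqrt_pinv {d : ℕ} {L Ld A B : Matrix (Fin d) (Fin d) ℝ}
    (hA : A.PosSemidef) (hAL : A * A = L) (hB : B.PosSemidef) (hBL : B * B = Ld)
    (hmp : IsMoorePenrose L Ld) : A * B = L * Ld := by
  obtain ⟨h1, h2, h3, h4⟩ := hmp
  have hAT : Aᵀ = A := by simpa using hA.isHermitian.eq
  have hBT : Bᵀ = B := by simpa using hB.isHermitian.eq
  have hLT : Lᵀ = L := by rw [← hAL, transpose_mul, hAT]
  have hLdT : Ldᵀ = Ld := by rw [← hBL, transpose_mul, hBT]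
  have hcomm : Ld * L = L * Ld := by rw [← h3, transpose_mul, hLT, hLdT]
  have hAQ : A * (L * Ld) = A := by
    have h0 : A * (L * Ld) - A = 0 := by
      apply Matrix.conjTranspose_mul_self_eq_zero.1
      simp only [conjTranspose_eq_transpose_of_trivial, transpose_sub, transpose_mul, hAT, hLT,
        hLdT]
      have : (Ld * L * A - A) * (A * (L * Ld) - A)
          = Ld * L * (A * A) * L * Ld - Ld * L * (A * A) - (A * A) * L * Ld + A * A := by
        noncomm_ring
      rw [this, hAL, hcomm, h1, Matrix.mul_assoc L L Ld, ← hcomm, ← Matrix.mul_assoc, h1]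
      simp
    exact sub_eq_zero.1 h0
  have hQA : Ld * L * A = A := by
    have := congrArg transpose hAQ
    rwa [transpose_mul, transpose_mul, hAT, hLT, hLdT] at this
  have hAL' : A * L = L * A := by rw [← hAL, Matrix.mul_assoc]
  have hLdA : Ld * A = A * Ld := by
    calc Ld * A = Ld * (A * (L * Ld)) := by rw [hAQ]
      _ = Ld * (A * L) * Ld := by simp only [Matrix.mul_assoc]
      _ = Ld * L * A * Ld := by rw [hAL']; simp only [Matrix.mul_assoc]
      _ = A * Ld := by rw [hQA]
  have hN : (A * Ld).PosSemidef := by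
    have : A * Ld = Ld * (A * A * A) * Ldᴴ := by
      rw [conjTranspose_eq_transpose_of_trivial, hLdT, hAL, ← Matrix.mul_assoc, hQA]
    rw [this]
    refine Matrix.PosSemidef.mul_mul_conjTranspose_same ?_ _
    have := hA.mul_mul_conjTranspose_same A
    rwa [conjTranspose_eq_transpose_of_trivial, hAT] at this
  have hNN : (A * Ld) * (A * Ld) = Ld := by
    calc (A * Ld) * (A * Ld) = A * (Ld * A) * Ld := by simp only [Matrix.mul_assoc]
      _ = (A * A) * Ld * Ld := by rw [hLdA]; simp only [Matrix.mul_assoc]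
      _ = Ld := by rw [hAL, ← hcomm, h2]
  have hBN : B = A * Ld := by
    open scoped MatrixOrder in
    have e1 := CFC.sqrt_unique hBL hB.nonneg
    open scoped MatrixOrder in
    have e2 := CFC.sqrt_unique hNN hN.nonneg
    exact e1.symm.trans e2
  rw [hBN, ← Matrix.mul_assoc, hAL]

/-- The gradient inequality for convex functions. -/
theorem ConvexOn.add_inner_gradient_le {d : ℕ} {f : Vec d → ℝ} (hc : ConvexOn ℝ Set.univ f)
    (hd : Differentiable ℝ f) (y z : Vec d) : f y + ⟪gradient f y, z - y⟫ ≤ f z := by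
  have hl : ConvexOn ℝ Set.univ (fun t : ℝ => f (AffineMap.lineMap y z t)) := by
    exact hc.comp_affineMap (AffineMap.lineMap y z : ℝ →ᵃ[ℝ] Vec d)
  have hder : HasDerivAt (fun t : ℝ => f (AffineMap.lineMap y z t)) ⟪gradient f y, z - y⟫ 0 := by
    have h1 : HasDerivAt (fun t : ℝ => AffineMap.lineMap y z t) (z - y) (0 : ℝ) :=
      AffineMap.hasDerivAt_lineMap
    have h2 : HasFDerivAt f (fderiv ℝ f y) (AffineMap.lineMap y z (0 : ℝ)) := by
      simpa using (hd y).hasFDerivAt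
    rw [inner_gradient_left]
    exact h2.comp_hasDerivAt (0 : ℝ) h1
  have := hl.le_slope_of_hasDerivAt (Set.mem_univ 0) (Set.mem_univ 1) zero_lt_one hder
  rw [slope_def_field, AffineMap.lineMap_apply_one, AffineMap.lineMap_apply_zero, sub_zero,
    div_one] at this
  linarith

/-- The Fenchel-type lower bound on the Bregman divergence of a convex smooth function. -/
theorem MSmooth.inner_sub_quad_le {d : ℕ} {f : Vec d → ℝ} {M : Matrix (Fin d) (Fin d) ℝ}
    (hM : MSmooth f M) (hc : ConvexOn ℝ Set.univ f) (hd : Differentiable ℝ f) (x y v : Vec d) :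
    ⟪gradient f x - gradient f y, v⟫ - 1 / 2 * quad M v
      ≤ f x - f y - ⟪gradient f y, x - y⟫ := by
  have h1 := hc.add_inner_gradient_le hd y (x - v)
  have h2 := hM (x - v) x
  have e1 : x - v - x = (-1 : ℝ) • v := by simp
  have e2 : x - v - y = x - y - v := by abel
  rw [e1, quad_smul, inner_smul_right] at h2
  rw [e2, inner_sub_right] at h1
  rw [inner_sub_left]
  linarith

theorem MSmooth.quad_pinv_le {d : ℕ} {f : Vec d → ℝ} {M Md : Matrix (Fin d) (Fin d) ℝ}
    (hM : MSmooth f M) (hc : ConvexOn ℝ Set.univ f) (hd : Differentiable ℝ f)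
    (hMdT : Mdᵀ = Md) (hmp : Md * M * Md = Md) (x y : Vec d) :
    quad Md (gradient f x - gradient f y) ≤ 2 * (f x - f y - ⟪gradient f y, x - y⟫) := by
  have h := hM.inner_sub_quad_le hc hd x y (mact Md (gradient f x - gradient f y))
  have e : quad M (mact Md (gradient f x - gradient f y))
      = quad Md (gradient f x - gradient f y) := by
    rw [quad, quad, ← mact_mul]
    nth_rewrite 1 [← hMdT]
    rw [← inner_mact, ← mact_mul, ← Matrix.mul_assoc, hmp]
  rw [e] at h
  change quad Md _ - _ ≤ _ at h
  linarith

theorem MSmooth.norm_sq_gradient_sub_le {d : ℕ} {f : Vec d → ℝ}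
    {M : Matrix (Fin d) (Fin d) ℝ} (hM : MSmooth f M) (hc : ConvexOn ℝ Set.univ f)
    (hd : Differentiable ℝ f) (hpsd : ∀ v, 0 ≤ quad M v) (x y : Vec d) :
    ‖gradient f x - gradient f y‖ ^ 2
      ≤ 2 * lambdaMax M * (f x - f y - ⟪gradient f y, x - y⟫) := by
  set Δ := gradient f x - gradient f y with hΔ
  set D := f x - f y - ⟪gradient f y, x - y⟫ with hD
  have key : ∀ t : ℝ, t * ‖Δ‖ ^ 2 - 1 / 2 * (t ^ 2 * (lambdaMax M * ‖Δ‖ ^ 2)) ≤ D := by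
    intro t
    have h := hM.inner_sub_quad_le hc hd x y (t • Δ)
    rw [← hΔ, ← hD, inner_smul_right, real_inner_self_eq_norm_sq, quad_smul] at h
    nlinarith [mul_le_mul_of_nonneg_left (quad_le_lambdaMax M Δ) (sq_nonneg t)]
  rcases (lambdaMax_nonneg hpsd).eq_or_lt with h0 | h0
  · rw [← h0] at key ⊢
    by_contra! hne
    have hpos : 0 < ‖Δ‖ ^ 2 := by simpa using hne
    have := key ((D + 1) / ‖Δ‖ ^ 2)
    rw [div_mul_cancel₀ _ hpos.ne'] at this
    linarith
  · have := key (lambdaMax M)⁻¹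
    have e : (lambdaMax M)⁻¹ * ‖Δ‖ ^ 2
        - 1 / 2 * ((lambdaMax M)⁻¹ ^ 2 * (lambdaMax M * ‖Δ‖ ^ 2))
        = ‖Δ‖ ^ 2 / (2 * lambdaMax M) := by
      field_simp; ring
    rw [e, div_le_iff₀ (by positivity)] at this
    linarith

/-- The gradient of a smooth function that is bounded below is fixed by the projection onto
the range of the smoothness matrix. -/
theorem MSmooth.mact_proj_gradient {d : ℕ} {f : Vec d → ℝ} {M Md : Matrix (Fin d) (Fin d) ℝ}
    (hM : MSmooth f M) (hb : BddBelow (Set.range f)) (hMT : Mᵀ = M)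
    (hmp : IsMoorePenrose M Md) (y : Vec d) :
    mact (M * Md) (gradient f y) = gradient f y := by
  obtain ⟨h1, -, h3, -⟩ := hmp
  set G := gradient f y with hG
  set r := G - mact (M * Md) G with hr
  have hMr : mact M r = 0 := by
    have e : M * (M * Md) = M := by
      have := congrArg transpose h1
      rwa [transpose_mul, h3, hMT] at this
    rw [hr, mact_sub, ← mact_mul, e, sub_self]
  have hGr : ⟪G, r⟫ = 0 := by
    obtain ⟨b, hb⟩ := hb
    by_contra hne
    have h := hM (y + ((b - f y - 1) / ⟪G, r⟫) • r) y
    have hbz := hb ⟨y + ((b - f y - 1) / ⟪G, r⟫) • r, rfl⟩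
    rw [add_sub_cancel_left, quad_smul, quad, hMr, inner_smul_right, ← hG,
      div_mul_cancel₀ _ hne, inner_zero_right] at h
    linarith
  have hQr : mact (M * Md) r = 0 := by
    rw [← h3, transpose_mul, hMT, mact_mul, hMr]
    simp [mact]
  have hrr : ⟪r, G - mact (M * Md) G⟫ = 0 := by
    rw [inner_sub_right, real_inner_comm, hGr, inner_mact, h3, hQr, inner_zero_left, sub_zero]
  exact (sub_eq_zero.1 (inner_self_eq_zero.1 hrr)).symm

section ProductExpectation

variable {ι κ : Type*} [Fintype ι] [Fintype κ]

theorem sum_prod_mul_eq_one [DecidableEq ι] (p : ι → κ → ℝ) (hp : ∀ i, ∑ s, p i s = 1) :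
    ∑ ω : ι → κ, ∏ i, p i (ω i) = 1 := by
  rw [← Fintype.prod_sum]
  simp [hp]

theorem sum_prod_mul_marginal [DecidableEq ι] (p : ι → κ → ℝ) (hp : ∀ i, ∑ s, p i s = 1)
    (i : ι) (φ : κ → ℝ) :
    ∑ ω : ι → κ, (∏ k, p k (ω k)) * φ (ω i) = ∑ s, p i s * φ s := by
  have h : ∀ ω : ι → κ, (∏ k, p k (ω k)) * φ (ω i)
      = ∏ k, p k (ω k) * (if k = i then φ (ω k) else 1) := fun ω => by
    rw [Finset.prod_mul_distrib, Finset.prod_ite_eq' Finset.univ i (fun k => φ (ω k))]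
    simp
  rw [Finset.sum_congr rfl fun ω _ => h ω,
    ← Fintype.prod_sum fun k s => p k s * (if k = i then φ s else 1), Finset.prod_eq_single i]
  · simp
  · intro k _ hk
    simp [hk, hp]
  · simp

theorem sum_prod_mul_mul_eq_zero [DecidableEq ι] (p : ι → κ → ℝ) {i j : ι} (hij : i ≠ j)
    (φ ψ : κ → ℝ) (hφ : ∑ s, p i s * φ s = 0) :
    ∑ ω : ι → κ, (∏ k, p k (ω k)) * (φ (ω i) * ψ (ω j)) = 0 := by
  have h : ∀ ω : ι → κ, (∏ k, p k (ω k)) * (φ (ω i) * ψ (ω j))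
      = ∏ k, p k (ω k) * ((if k = i then φ (ω k) else 1) * (if k = j then ψ (ω k) else 1)) :=
    fun ω => by
      rw [Finset.prod_mul_distrib, Finset.prod_mul_distrib,
        Finset.prod_ite_eq' Finset.univ i (fun k => φ (ω k)),
        Finset.prod_ite_eq' Finset.univ j (fun k => ψ (ω k))]
      simp
  rw [Finset.sum_congr rfl fun ω _ => h ω,
    ← Fintype.prod_sum fun k s =>
      p k s * ((if k = i then φ s else 1) * (if k = j then ψ s else 1))]
  exact Finset.prod_eq_zero (Finset.mem_univ i) (by simpa [hij] using hφ)

theorem sum_prod_mul_sum_add_sq [DecidableEq ι] (p : ι → κ → ℝ) (hp : ∀ i, ∑ s, p i s = 1)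
    (Z : ι → κ → ℝ) (hZ : ∀ i, ∑ s, p i s * Z i s = 0) (c : ℝ) :
    ∑ ω : ι → κ, (∏ k, p k (ω k)) * (∑ i, Z i (ω i) + c) ^ 2
      = ∑ i, ∑ s, p i s * Z i s ^ 2 + c ^ 2 := by
  have h : ∀ ω : ι → κ, (∏ k, p k (ω k)) * (∑ i, Z i (ω i) + c) ^ 2
      = ∑ i, ∑ j, (∏ k, p k (ω k)) * (Z i (ω i) * Z j (ω j))
        + 2 * c * ∑ i, (∏ k, p k (ω k)) * Z i (ω i) + c ^ 2 * ∏ k, p k (ω k) := fun ω => by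
    simp only [← Finset.mul_sum, ← Finset.sum_mul]
    ring
  rw [Finset.sum_congr rfl fun ω _ => h ω, Finset.sum_add_distrib, Finset.sum_add_distrib,
    ← Finset.mul_sum, ← Finset.mul_sum, sum_prod_mul_eq_one p hp, Finset.sum_comm,
    Finset.sum_comm (f := fun (ω : ι → κ) i => (∏ k, p k (ω k)) * Z i (ω i))]
  simp only [sum_prod_mul_marginal p hp, hZ, Finset.sum_const_zero, mul_zero, add_zero, mul_one]
  congr 1
  refine Finset.sum_congr rfl fun i _ => ?_
  rw [Finset.sum_comm, Finset.sum_eq_single i]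
  · simpa only [sq] using sum_prod_mul_marginal p hp i fun s => Z i s * Z i s
  · exact fun j _ hj => sum_prod_mul_mul_eq_zero p hj.symm _ _ (hZ i)
  · simp

theorem sum_prod_smul_marginal {d : ℕ} [DecidableEq ι] (p : ι → κ → ℝ)
    (hp : ∀ i, ∑ s, p i s = 1) (i : ι) (Z : κ → Vec d) :
    ∑ ω : ι → κ, (∏ k, p k (ω k)) • Z (ω i) = ∑ s, p i s • Z s := by
  ext c
  simpa using sum_prod_mul_marginal p hp i fun s => Z s c

/-- The bias-variance decomposition for a sum of independent centred random vectors. -/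
theorem sum_prod_mul_norm_sum_add_sq {d : ℕ} [DecidableEq ι] (p : ι → κ → ℝ)
    (hp : ∀ i, ∑ s, p i s = 1) (Z : ι → κ → Vec d) (hZ : ∀ i, ∑ s, p i s • Z i s = 0)
    (c : Vec d) :
    ∑ ω : ι → κ, (∏ k, p k (ω k)) * ‖∑ i, Z i (ω i) + c‖ ^ 2
      = ∑ i, ∑ s, p i s * ‖Z i s‖ ^ 2 + ‖c‖ ^ 2 := by
  have hZ' : ∀ (a : Fin d) (i : ι), ∑ s, p i s * Z i s a = 0 := fun a i => by
    simpa using congrArg (fun v : Vec d => v a) (hZ i)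
  have key := fun a : Fin d => sum_prod_mul_sum_add_sq p hp (fun i s => Z i s a) (hZ' a) (c a)
  simp only [EuclideanSpace.real_norm_sq_eq, PiLp.add_apply, WithLp.ofLp_sum, Finset.sum_apply,
    Finset.mul_sum]
  rw [Finset.sum_comm, Finset.sum_congr rfl fun a _ => key a, Finset.sum_add_distrib,
    Finset.sum_comm]
  congr 1
  exact Finset.sum_congr rfl fun i _ => Finset.sum_comm

end ProductExpectation

namespace Sampling

variable {d : ℕ} (μ : Sampling d)

theorem sum_prob_mul_indicator (j : Fin d) :
    ∑ S, μ.prob S * (if j ∈ S then (μ.marg j)⁻¹ else 0) = 1 := by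
  have h : μ.marg j * (μ.marg j)⁻¹ = 1 := mul_inv_cancel₀ (μ.margPos j).ne'
  rw [← h]
  conv_rhs => rw [marg]
  rw [Finset.sum_mul]
  exact Finset.sum_congr rfl fun S _ => by split_ifs <;> simp [marg]

theorem sum_prob_smul_mact_sketch (w : Vec d) :
    ∑ S, μ.prob S • mact (μ.sketch S) w = w := by
  ext j
  have h := congrArg (· * w j) (μ.sum_prob_mul_indicator j)
  simp only [Finset.sum_mul, one_mul] at h
  conv_rhs => rw [← h]
  simp [mact, Matrix.toLpLin_apply, sketch, Matrix.mulVec_diagonal, mul_assoc]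

theorem sum_prob_mul_centered (j l : Fin d) :
    ∑ S, μ.prob S * (((if j ∈ S then (μ.marg j)⁻¹ else 0) - 1)
      * ((if l ∈ S then (μ.marg l)⁻¹ else 0) - 1)) = μ.Ptilde j l := by
  have h : ∀ S, μ.prob S * (((if j ∈ S then (μ.marg j)⁻¹ else 0) - 1)
      * ((if l ∈ S then (μ.marg l)⁻¹ else 0) - 1))
      = (if j ∈ S ∧ l ∈ S then μ.prob S else 0) / (μ.marg j * μ.marg l)
        - μ.prob S * (if j ∈ S then (μ.marg j)⁻¹ else 0)
        - μ.prob S * (if l ∈ S then (μ.marg l)⁻¹ else 0) + μ.prob S := fun S => by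
    by_cases hj : j ∈ S <;> by_cases hl : l ∈ S <;> simp [hj, hl] <;> ring
  rw [Finset.sum_congr rfl fun S _ => h S]
  simp only [Finset.sum_add_distrib, Finset.sum_sub_distrib, sum_prob_mul_indicator, μ.total,
    ← Finset.sum_div]
  simp [Ptilde, Pbar, probMatrix]

theorem quad_Ptilde_hadamard (L : Matrix (Fin d) (Fin d) ℝ) (w : Vec d) :
    ∑ S, μ.prob S * quad L (mact (μ.sketch S) w - w) = quad (μ.Ptilde ⊙ L) w := by
  have h : ∀ S, μ.prob S * quad L (mact (μ.sketch S) w - w)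
      = ∑ j, ∑ l, μ.prob S * (((if j ∈ S then (μ.marg j)⁻¹ else 0) - 1)
        * ((if l ∈ S then (μ.marg l)⁻¹ else 0) - 1)) * (w j * L j l * w l) := fun S => by
    rw [quad_eq_dotProduct]
    simp only [dotProduct, Matrix.mulVec, Finset.mul_sum]
    refine Finset.sum_congr rfl fun j _ => Finset.sum_congr rfl fun l _ => ?_
    simp only [mact, Matrix.toLpLin_apply, sketch, PiLp.sub_apply, Matrix.mulVec_diagonal]
    ring
  rw [Finset.sum_congr rfl fun S _ => h S, Finset.sum_comm, quad_eq_dotProduct]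
  simp only [dotProduct, Matrix.mulVec, Finset.mul_sum]
  refine Finset.sum_congr rfl fun j _ => ?_
  rw [Finset.sum_comm]
  refine Finset.sum_congr rfl fun l _ => ?_
  rw [← Finset.sum_mul, sum_prob_mul_centered, Matrix.hadamard_apply]
  ring

end Sampling

theorem quad_nonneg {d : ℕ} {M : Matrix (Fin d) (Fin d) ℝ} (hM : M.PosSemidef) (x : Vec d) :
    0 ≤ quad M x := by
  rw [quad_eq_dotProduct]
  simpa using (posSemidef_iff_dotProduct_mulVec.1 hM).2 x.ofLp

theorem quad_sub_le {d : ℕ} {M : Matrix (Fin d) (Fin d) ℝ} (hM : M.PosSemidef) (x y : Vec d) :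
    quad M (x - y) ≤ 2 * quad M x + 2 * quad M y := by
  have h := quad_nonneg hM (x + y)
  simp only [quad, mact_add, mact_sub, inner_add_left, inner_add_right, inner_sub_left,
    inner_sub_right] at h ⊢
  linarith

theorem gradient_average {d n : ℕ} {fi : Fin n → Vec d → ℝ} (hd : ∀ i, Differentiable ℝ (fi i))
    (x : Vec d) :
    gradient (fun x => (1 / (n : ℝ)) * ∑ i, fi i x) x
      = (1 / (n : ℝ)) • ∑ i, gradient (fi i) x := by
  apply HasGradientAt.gradient
  rw [hasGradientAt_iff_hasFDerivAt, map_smul, map_sum]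
  refine HasFDerivAt.const_mul ?_ _
  exact HasFDerivAt.fun_sum fun i _ => (hd i x).hasGradientAt.hasFDerivAt

/-- DIANA+ gradient-estimator bound. With shifts `h_i ∈ range(L_i)` and
`g = (1/n) Σ_i [C̄_i (∇f_i(x) − h_i) + h_i]`, the estimator is unbiased and satisfies
`E‖g − ∇f(y)‖² ≤ 2(L + 2L̃max/n) D_f(x,y) + (2L̃max/n)(1/n) Σ_i ‖h_i − ∇f_i(y)‖²_{L_i†}`. -/
theorem statement11 {d n : ℕ} (hn : 0 < n) (μs : Fin n → Sampling d)
    (fi : Fin n → Vec d → ℝ) (Li Lih Lidag Lidh : Fin n → Matrix (Fin d) (Fin d) ℝ)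
    (hLi : ∀ i, (Li i).PosSemidef)
    (hfi : ∀ i, Differentiable ℝ (fi i) ∧ ConvexOn ℝ Set.univ (fi i) ∧
      BddBelow (Set.range (fi i)) ∧ MSmooth (fi i) (Li i))
    (hLih : ∀ i, (Lih i).PosSemidef ∧ Lih i * Lih i = Li i)
    (hLidag : ∀ i, IsMoorePenrose (Li i) (Lidag i))
    (hLidh : ∀ i, (Lidh i).PosSemidef ∧ Lidh i * Lidh i = Lidag i)
    (f : Vec d → ℝ) (hf : f = fun x => (1 / (n : ℝ)) * ∑ i, fi i x)
    (LL : Matrix (Fin d) (Fin d) ℝ) (hLL : LL.PosSemidef) (hfLL : MSmooth f LL)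
    (hfbdd : BddBelow (Set.range f))
    (Ltilmax : ℝ) (hLtilmax : Ltilmax = ⨆ i, lambdaMax (Matrix.hadamard (μs i).Ptilde (Li i)))
    (h : Fin n → Vec d) (hh : ∀ i, h i ∈ Set.range (mact (Li i)))
    (x : Vec d) (g : (Fin n → Finset (Fin d)) → Vec d)
    (hg : g = fun ω => (1 / (n : ℝ)) •
      ∑ i, (mact (Lih i * (μs i).sketch (ω i) * Lidh i) (gradient (fi i) x - h i) + h i)) :
    (∑ ω : Fin n → Finset (Fin d), (∏ i, (μs i).prob (ω i)) • g ω) = gradient f x ∧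
    ∀ y : Vec d,
      (∑ ω : Fin n → Finset (Fin d),
          (∏ i, (μs i).prob (ω i)) * ‖g ω - gradient f y‖ ^ 2)
        ≤ 2 * (lambdaMax LL + 2 * Ltilmax / (n : ℝ))
            * (f x - f y - ⟪gradient f y, x - y⟫)
          + (2 * Ltilmax / (n : ℝ)) * ((1 / (n : ℝ)) * ∑ i,
              quad (Lidag i) (h i - gradient (fi i) y)) := by
  have hp : ∀ i, ∑ S, (μs i).prob S = 1 := fun i => (μs i).total
  have hLT : ∀ i, (Li i)ᵀ = Li i := fun i => by simpa using (hLi i).isHermitian.eq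
  have hAT : ∀ i, (Lih i)ᵀ = Lih i := fun i => by simpa using (hLih i).1.isHermitian.eq
  have hBT : ∀ i, (Lidh i)ᵀ = Lidh i := fun i => by simpa using (hLidh i).1.isHermitian.eq
  have hLdT : ∀ i, (Lidag i)ᵀ = Lidag i := fun i => by
    rw [← (hLidh i).2, transpose_mul, hBT]
  have hLdpsd : ∀ i, (Lidag i).PosSemidef := fun i => by
    have := Matrix.posSemidef_conjTranspose_mul_self (Lidh i)
    rwa [conjTranspose_eq_transpose_of_trivial, hBT, (hLidh i).2] at this
  set a : Fin n → Vec d := fun i => gradient (fi i) x - h i with ha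
  set w : Fin n → Vec d := fun i => mact (Lidh i) (a i) with hw
  have hAw : ∀ i, mact (Lih i) (w i) = a i := fun i => by
    obtain ⟨u, hu⟩ := hh i
    rw [hw, ← mact_mul, sqrt_mul_sqrt_pinv (hLih i).1 (hLih i).2 (hLidh i).1 (hLidh i).2
      (hLidag i)]
    simp only [ha]
    rw [mact_sub, (hfi i).2.2.2.mact_proj_gradient (hfi i).2.2.1 (hLT i) (hLidag i), ← hu,
      ← mact_mul, (hLidag i).1]
  have hgrad : ∀ y, gradient f y = (1 / (n : ℝ)) • ∑ i, gradient (fi i) y := fun y => by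
    rw [hf]
    exact gradient_average (fun i => (hfi i).1) y
  set Z : Fin n → Finset (Fin d) → Vec d := fun i S =>
    (1 / (n : ℝ)) • mact (Lih i) (mact ((μs i).sketch S) (w i) - w i) with hZdef
  have hZ : ∀ i, ∑ S, (μs i).prob S • Z i S = 0 := fun i => by
    have e : ∀ S, (μs i).prob S • Z i S = (1 / (n : ℝ)) • mact (Lih i)
        ((μs i).prob S • mact ((μs i).sketch S) (w i) - (μs i).prob S • w i) := fun S => by
      rw [hZdef, ← smul_sub, mact_smul, smul_comm]
    rw [Finset.sum_congr rfl fun S _ => e S, ← Finset.smul_sum]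
    simp only [mact]
    rw [← map_sum, Finset.sum_sub_distrib, ← Finset.sum_smul, hp, one_smul]
    have := (μs i).sum_prob_smul_mact_sketch (w i)
    simp only [mact] at this
    rw [this, sub_self, map_zero, smul_zero]
  have hgZ : ∀ ω, g ω = ∑ i, Z i (ω i) + gradient f x := fun ω => by
    rw [hg, hgrad]
    simp only [hZdef]
    rw [← Finset.smul_sum, ← smul_add, ← Finset.sum_add_distrib]
    congr 1
    refine Finset.sum_congr rfl fun i _ => ?_
    rw [mact_sub (Lih i), hAw, mact_mul, mact_mul]
    simp only [hw, ha]
    abel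
  refine ⟨?_, fun y => ?_⟩
  · simp only [hgZ, smul_add, Finset.sum_add_distrib, Finset.smul_sum]
    rw [Finset.sum_comm, ← Finset.sum_smul, sum_prod_mul_eq_one _ hp, one_smul]
    simp [sum_prod_smul_marginal _ hp, hZ]
  have hvar : ∀ i, ∑ S, (μs i).prob S * ‖Z i S‖ ^ 2
      = (1 / (n : ℝ)) ^ 2 * quad ((μs i).Ptilde ⊙ Li i) (w i) := fun i => by
    rw [← Sampling.quad_Ptilde_hadamard, Finset.mul_sum]
    refine Finset.sum_congr rfl fun S _ => ?_
    rw [← (hLih i).2, quad_mul_self (hAT i)]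
    simp only [hZdef]
    rw [norm_smul, mul_pow, Real.norm_eq_abs, sq_abs]
    ring
  have hPnn : ∀ i, 0 ≤ lambdaMax ((μs i).Ptilde ⊙ Li i) := fun i =>
    lambdaMax_nonneg fun v => by
      rw [← Sampling.quad_Ptilde_hadamard]
      exact Finset.sum_nonneg fun S _ =>
        mul_nonneg ((μs i).nonneg S) (quad_nonneg (hLi i) _)
  have hle : ∀ i, lambdaMax ((μs i).Ptilde ⊙ Li i) ≤ Ltilmax := fun i => by
    rw [hLtilmax]
    exact le_ciSup (f := fun i => lambdaMax ((μs i).Ptilde ⊙ Li i))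
      (Set.finite_range _).bddAbove i
  have hLnn : 0 ≤ Ltilmax := (hPnn ⟨0, hn⟩).trans (hle _)
  have hbound : ∀ i, quad ((μs i).Ptilde ⊙ Li i) (w i) ≤ Ltilmax *
      (4 * (fi i x - fi i y - ⟪gradient (fi i) y, x - y⟫)
        + 2 * quad (Lidag i) (h i - gradient (fi i) y)) := fun i => by
    have h1 := quad_le_lambdaMax ((μs i).Ptilde ⊙ Li i) (w i)
    have h2 : ‖w i‖ ^ 2 = quad (Lidag i) (a i) := by
      rw [← (hLidh i).2, quad_mul_self (hBT i)]
    have h3 : a i = (gradient (fi i) x - gradient (fi i) y) - (h i - gradient (fi i) y) := by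
      simp only [ha]
      abel
    have h4 := quad_sub_le (hLdpsd i) (gradient (fi i) x - gradient (fi i) y)
      (h i - gradient (fi i) y)
    have h5 := (hfi i).2.2.2.quad_pinv_le (hfi i).2.1 (hfi i).1 (hLdT i) (hLidag i).2.1 x y
    rw [← h3, ← h2] at h4
    calc _ ≤ lambdaMax ((μs i).Ptilde ⊙ Li i) * ‖w i‖ ^ 2 := h1
      _ ≤ Ltilmax * ‖w i‖ ^ 2 := mul_le_mul_of_nonneg_right (hle i) (sq_nonneg _)
      _ ≤ _ := mul_le_mul_of_nonneg_left (by linarith) hLnn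
  have hfd : Differentiable ℝ f := by
    rw [hf]
    exact (Differentiable.fun_sum fun i _ => (hfi i).1).const_mul _
  have hfc : ConvexOn ℝ Set.univ f := by
    rw [hf]
    refine ConvexOn.smul (by positivity) ?_
    refine ⟨convex_univ, fun u _ v _ s t hs ht hst => ?_⟩
    simp only [smul_eq_mul, Finset.mul_sum]
    rw [← Finset.sum_add_distrib]
    exact Finset.sum_le_sum fun i _ =>
      (hfi i).2.1.2 (Set.mem_univ u) (Set.mem_univ v) hs ht hst
  have hD : f x - f y - ⟪gradient f y, x - y⟫
      = (1 / (n : ℝ)) * ∑ i, (fi i x - fi i y - ⟪gradient (fi i) y, x - y⟫) := by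
    rw [hgrad, hf, inner_smul_left, sum_inner, Finset.sum_sub_distrib, Finset.sum_sub_distrib]
    simp only [conj_trivial]
    ring
  have hmain := sum_prod_mul_norm_sum_add_sq (fun i => (μs i).prob) hp Z hZ
    (gradient f x - gradient f y)
  have hbias := hfLL.norm_sq_gradient_sub_le hfc hfd (quad_nonneg hLL) x y
  simp only [hgZ, add_sub_assoc]
  rw [hmain]
  have hsum : ∑ i, ∑ S, (μs i).prob S * ‖Z i S‖ ^ 2 ≤ (1 / (n : ℝ)) ^ 2 * (Ltilmax *
      (4 * ∑ i, (fi i x - fi i y - ⟪gradient (fi i) y, x - y⟫)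
        + 2 * ∑ i, quad (Lidag i) (h i - gradient (fi i) y))) := by
    rw [Finset.sum_congr rfl fun i _ => hvar i, ← Finset.mul_sum]
    refine mul_le_mul_of_nonneg_left ((Finset.sum_le_sum fun i _ => hbound i).trans_eq ?_)
      (by positivity)
    rw [← Finset.mul_sum, Finset.sum_add_distrib, ← Finset.mul_sum, ← Finset.mul_sum]
  refine (add_le_add hsum hbias).trans (le_of_eq ?_)
  rw [hD]
  ring

end
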